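/- arXiv:2103.03985 — 2 statements merged into one kernel-verified Lean document; each statement's English description precedes it below -/
import Mathlib

section
/- Let H and H' be real normed vector spaces (H a Hilbert space), let Y be a nonempty type (the parameter set), and for each y ∈ Y let A(y) : H → H' be a continuous linear equivalence with operator norm ‖A(y)‖ ≤ R and inverse norm ‖A(y)⁻¹‖ ≤ 1/r, where 0 < r ≤ R, and let f(y) ∈ H'. Let u(y) = A(y)⁻¹ f(y) and let M = {u(y) : y ∈ Y} be the solution manifold. Define the surrogate distance S(v) = inf_{y ∈ Y} ‖A(y) v − f(y)‖. Then for every v ∈ H, r·dist(v, M) ≤ S(v) ≤ R·dist(v, M), where dist(v, M) = inf_{z ∈ M} ‖v − z‖. -/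
/-- The residual-based surrogate distance S(v) = inf_y ‖A(y)v − f(y)‖ is
uniformly equivalent to the distance from v to the solution manifold. -/
theorem surrogate_distance_equivalence
    {H H' : Type*} [NormedAddCommGroup H] [InnerProductSpace ℝ H] [CompleteSpace H]
    [NormedAddCommGroup H'] [NormedSpace ℝ H']
    {Y : Type*} [Nonempty Y]
    (A : Y → (H ≃L[ℝ] H')) (f : Y → H')
    (r R : ℝ) (hr : 0 < r) (hrR : r ≤ R)
    (hA : ∀ y : Y, ‖(A y : H →L[ℝ] H')‖ ≤ R)
    (hAinv : ∀ y : Y, ‖((A y).symm : H' →L[ℝ] H)‖ ≤ 1 / r)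
    (u : Y → H) (hu : ∀ y, u y = (A y).symm (f y))
    (M : Set H) (hM : M = Set.range u) :
    ∀ v : H,
      r * Metric.infDist v M ≤ (⨅ y : Y, ‖(A y) v - f y‖) ∧
      (⨅ y : Y, ‖(A y) v - f y‖) ≤ R * Metric.infDist v M := by
  intro v
  subst hM
  have hR : 0 < R := hr.trans_le hrR
  have hres : ∀ y, A y v - f y = A y (v - u y) := fun y => by
    rw [map_sub, hu, ContinuousLinearEquiv.apply_symm_apply]
  have hbdd : BddBelow (Set.range fun y => ‖A y v - f y‖) :=
    ⟨0, Set.forall_mem_range.2 fun y => norm_nonneg _⟩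
  constructor
  · refine le_ciInf fun y => ?_
    have hinv : ‖v - u y‖ ≤ 1 / r * ‖A y v - f y‖ := by
      simpa [hres] using
        ((A y).symm : H' →L[ℝ] H).le_of_opNorm_le (hAinv y) (A y (v - u y))
    calc r * Metric.infDist v (Set.range u) ≤ r * ‖v - u y‖ := by
          rw [← dist_eq_norm]
          gcongr
          exact Metric.infDist_le_dist_of_mem ⟨y, rfl⟩
      _ ≤ r * (1 / r * ‖A y v - f y‖) := by gcongr
      _ = ‖A y v - f y‖ := by field_simp
  · rw [← div_le_iff₀' hR, Metric.le_infDist (Set.range_nonempty u), Set.forall_mem_range]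
    intro y
    rw [div_le_iff₀' hR, dist_eq_norm]
    calc (⨅ y, ‖A y v - f y‖) ≤ ‖A y v - f y‖ := ciInf_le hbdd y
      _ = ‖A y (v - u y)‖ := by rw [hres]
      _ ≤ R * ‖v - u y‖ := (A y : H →L[ℝ] H').le_of_opNorm_le (hA y) _
end

section
/- Let E be a real normed vector space, Y a nonempty type, and e, e_h : Y → E two functions. Suppose y* ∈ Y is a minimizer of y ↦ ‖e(y)‖ (that is, ‖e(y*)‖ ≤ ‖e(y)‖ for all y ∈ Y) and y*_h ∈ Y is a minimizer of y ↦ ‖e_h(y)‖. Then |‖e(y*)‖ − ‖e_h(y*_h)‖| ≤ ‖e(y*) − e_h(y*)‖ + ‖e(y*_h) − e_h(y*_h)‖. -/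
/-- Bound on the difference of the minimal residual norms of two families
e and e_h, in terms of the discrepancies at the respective minimizers. -/
theorem min_residual_difference_bound
    {E : Type*} [NormedAddCommGroup E]
    {Y : Type*} [Nonempty Y]
    (e eh : Y → E)
    (ystar ystarh : Y)
    (hmin : ∀ y : Y, ‖e ystar‖ ≤ ‖e y‖)
    (hminh : ∀ y : Y, ‖eh ystarh‖ ≤ ‖eh y‖) :
    |‖e ystar‖ - ‖eh ystarh‖| ≤ ‖e ystar - eh ystar‖ + ‖e ystarh - eh ystarh‖ := by
  have h₁ : ‖eh ystar‖ - ‖e ystar‖ ≤ ‖e ystar - eh ystar‖ :=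
    norm_sub_rev (e ystar) (eh ystar) ▸ norm_sub_norm_le _ _
  have h₂ : ‖e ystarh‖ - ‖eh ystarh‖ ≤ ‖e ystarh - eh ystarh‖ := norm_sub_norm_le _ _
  rw [abs_le]
  constructor
  · linarith [hminh ystar, norm_nonneg (e ystarh - eh ystarh)]
  · linarith [hmin ystarh, norm_nonneg (e ystar - eh ystar)]
end
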